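/- arXiv:2405.06292 — 3 statements merged into one kernel-verified Lean document; each statement's English description precedes it below -/
import Mathlib

section
/- Let C_i be an [n,k_i,d_i]_q linear code with 0 < k_i < n and Euclidean dual distance d_i^{⊥E} for i = 1,…,s, let A be an s×s non-singular by columns (NSC) matrix over F_q, and let C(A) = [C_1,…,C_s]·A. Let 0 ≤ e' ≤ h−1, let M_{τ'} be an sn×sn monomial matrix over F_q, and set σ' = (M_{τ'}, e'). Then C(A) has length sn, dimension Σ_{i=1}^s k_i, and minimum distance at least min{(s+1−i)·d_i : 1 ≤ i ≤ s}, while C(A)^{⊥σ'} has length sn, dimension sn − Σ_{i=1}^s k_i, and minimum distance at least min{i·d_i^{⊥E} : 1 ≤ i ≤ s}. -/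
open Matrix Finset Kronecker

variable {F : Type} [Field F] [DecidableEq F]

/-- Entrywise application of the map `π_e : x ↦ x ^ (p ^ e)` to a matrix. -/
def piE (p e : ℕ) {m n : Type} (A : Matrix m n F) : Matrix m n F :=
  A.map fun x => x ^ p ^ e

/-- Entrywise application of `π_e` to a vector. -/
def piEv (p e : ℕ) {n : Type} (v : n → F) : n → F := fun i => v i ^ p ^ e

/-- A monomial matrix: exactly one nonzero entry in each row and each column. -/
def IsMonomial {n : Type} [Fintype n] (M : Matrix n n F) : Prop :=
  (∀ i, ∃! j, M i j ≠ 0) ∧ (∀ j, ∃! i, M i j ≠ 0)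

/-- Non-singular by columns (NSC): for each `ℓ`, every `ℓ × ℓ` submatrix formed by the first
`ℓ` rows and any `ℓ` columns (in increasing order) is non-singular. -/
def IsNSC {s : ℕ} (A : Matrix (Fin s) (Fin s) F) : Prop :=
  ∀ (ℓ : ℕ) (hℓ : ℓ ≤ s) (j : Fin ℓ → Fin s), StrictMono j →
    (Matrix.of fun a b : Fin ℓ => A (Fin.castLE hℓ a) (j b)).det ≠ 0

/-- Toeplitz matrix: constant along diagonals. -/
def IsToeplitz {s : ℕ} (A : Matrix (Fin s) (Fin s) F) : Prop :=
  ∀ (i j : ℕ) (hi : i + 1 < s) (hj : j + 1 < s),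
    A ⟨i, Nat.lt_of_succ_lt hi⟩ ⟨j, Nat.lt_of_succ_lt hj⟩ = A ⟨i + 1, hi⟩ ⟨j + 1, hj⟩

/-- The anti-diagonal matrix `Q` with ones on the anti-diagonal. -/
def antiDiagQ (F : Type) [Field F] (s : ℕ) : Matrix (Fin s) (Fin s) F :=
  Matrix.of fun i j => if (i : ℕ) + (j : ℕ) + 1 = s then 1 else 0

/-- Dual of a code with respect to the pairing `⟨u, c⟩ = ∑ j, u j * g c j`. -/
def dualWith {n : Type} [Fintype n] (g : (n → F) → n → F) (C : Submodule F (n → F)) :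
    Submodule F (n → F) where
  carrier := {u | ∀ c ∈ C, ∑ j, u j * g c j = 0}
  add_mem' := by
    intro a b ha hb c hc
    simp only [Pi.add_apply, add_mul, Finset.sum_add_distrib, ha c hc, hb c hc, add_zero]
  zero_mem' := by
    intro c hc
    simp
  smul_mem' := by
    intro r a ha c hc
    simp only [Pi.smul_apply, smul_eq_mul, mul_assoc, ← Finset.mul_sum, ha c hc, mul_zero]

/-- The `σ = (M, e)` dual of a linear code. -/
def sigmaDual {n : Type} [Fintype n] (p e : ℕ) (M : Matrix n n F)
    (C : Submodule F (n → F)) : Submodule F (n → F) :=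
  dualWith (fun c => Matrix.vecMul (piEv p e c) M) C

/-- The Euclidean dual of a linear code. -/
def euclidDual {n : Type} [Fintype n] (C : Submodule F (n → F)) : Submodule F (n → F) :=
  dualWith id C

/-- The matrix-product code `[C_1, …, C_s] · A`, realized inside `Fin s × Fin n → F`
(block `j` of a codeword is `∑ i, A i j • c i`). -/
def matrixProductCode {n s : ℕ} (C : Fin s → Submodule F (Fin n → F))
    (A : Matrix (Fin s) (Fin s) F) : Submodule F (Fin s × Fin n → F) where
  carrier := {x | ∃ c : Fin s → Fin n → F, (∀ i, c i ∈ C i) ∧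
    ∀ jt : Fin s × Fin n, x jt = ∑ i, A i jt.1 * c i jt.2}
  add_mem' := by
    rintro x y ⟨c, hc, hx⟩ ⟨d, hd, hy⟩
    refine ⟨c + d, fun i => (C i).add_mem (hc i) (hd i), fun jt => ?_⟩
    simp [hx jt, hy jt, mul_add, Finset.sum_add_distrib]
  zero_mem' := ⟨0, fun i => (C i).zero_mem, fun jt => by simp⟩
  smul_mem' := by
    rintro r x ⟨c, hc, hx⟩
    refine ⟨r • c, fun i => (C i).smul_mem r (hc i), fun jt => ?_⟩
    simp [hx jt, Finset.mul_sum, mul_left_comm]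

/-- The minimum distance of the code `C` is at least `d`. -/
def minDistGe {n : Type} [Fintype n] (C : Submodule F (n → F)) (d : ℕ) : Prop :=
  ∀ x ∈ C, x ≠ 0 → d ≤ hammingNorm x

/-- The code `C` has minimum distance exactly `d`. -/
def minDistEq {n : Type} [Fintype n] (C : Submodule F (n → F)) (d : ℕ) : Prop :=
  minDistGe C d ∧ ∃ x ∈ C, x ≠ 0 ∧ hammingNorm x = d

theorem sum_eq_sum_castLE {M : Type*} [AddCommMonoid M] {l s : ℕ} (hl : l ≤ s) (f : Fin s → M)
    (hf : ∀ i : Fin s, l ≤ i → f i = 0) : ∑ i, f i = ∑ a : Fin l, f (Fin.castLE hl a) := by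
  refine (Fintype.sum_of_injective (Fin.castLE hl) (Fin.castLE_injective hl) _ _ ?_
    fun _ => rfl).symm
  intro i hi
  refine hf i (not_lt.mp fun h => hi ⟨⟨i, h⟩, rfl⟩)

/-- A combination of the rows `0, …, m` of an NSC matrix whose last coefficient is nonzero
vanishes in at most `m` columns. -/
theorem IsNSC.le_hammingNorm_vecMul {s : ℕ} {A : Matrix (Fin s) (Fin s) F} (hA : IsNSC A)
    {v : Fin s → F} {m : Fin s} (hv : ∀ i, m < i → v i = 0) (hm : v m ≠ 0) :
    s - (m : ℕ) ≤ hammingNorm (v ᵥ* A) := by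
  by_contra! hlt
  have hsplit := Finset.card_filter_add_card_filter_not (s := (univ : Finset (Fin s)))
    (fun j => (v ᵥ* A) j ≠ 0)
  rw [Finset.card_univ, Fintype.card_fin] at hsplit
  have hlt' : #{j | (v ᵥ* A) j ≠ 0} < s - (m : ℕ) := hlt
  obtain ⟨J, hJ, hJc⟩ := Finset.exists_subset_card_eq
    (show (m : ℕ) + 1 ≤ #{j | ¬ (v ᵥ* A) j ≠ 0} by omega)
  refine hm ?_
  have key := Matrix.eq_zero_of_vecMul_eq_zero (hA (m + 1) m.2 (J.orderEmbOfFin hJc)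
    (J.orderEmbOfFin hJc).strictMono) (v := fun a => v (Fin.castLE m.2 a)) (by
      ext b
      have hb := hJ (J.orderEmbOfFin_mem hJc b)
      simp only [ne_eq, not_not, mem_filter, mem_univ, true_and] at hb
      rw [Pi.zero_apply, ← hb]
      refine (sum_eq_sum_castLE m.2 (fun i => v i * A i (J.orderEmbOfFin hJc b)) ?_).symm
      intro i hi
      rw [hv i hi, zero_mul])
  exact congrFun key (Fin.last m)

/-- If `A *ᵥ u` vanishes in the rows before `m` but not in row `m`, with `A` an NSC matrix,
then `u` has weight at least `m + 1`. -/
theorem IsNSC.le_hammingNorm_of_mulVec {s : ℕ} {A : Matrix (Fin s) (Fin s) F} (hA : IsNSC A)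
    {u : Fin s → F} {m : Fin s} (hu : ∀ i, i < m → (A *ᵥ u) i = 0) (hm : (A *ᵥ u) m ≠ 0) :
    (m : ℕ) + 1 ≤ hammingNorm u := by
  by_contra! hlt
  set J : Finset (Fin s) := {j | u j ≠ 0} with hJ
  have hJm : #J ≤ (m : ℕ) := Nat.lt_succ_iff.mp hlt
  have hJs : #J ≤ s := hJm.trans m.2.le
  have hsum (i : Fin s) : (A *ᵥ u) i =
      ∑ b, A i (J.orderEmbOfFin rfl b) * u (J.orderEmbOfFin rfl b) := by
    refine (Fintype.sum_of_injective (J.orderEmbOfFin rfl) (J.orderEmbOfFin rfl).injective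
      _ _ ?_ fun _ => rfl).symm
    intro j hj
    rw [Finset.range_orderEmbOfFin] at hj
    have : u j = 0 := by simpa [hJ] using hj
    rw [this, mul_zero]
  have key := Matrix.eq_zero_of_mulVec_eq_zero (hA #J hJs (J.orderEmbOfFin rfl)
    (J.orderEmbOfFin rfl).strictMono) (v := fun b => u (J.orderEmbOfFin rfl b)) (by
      ext a
      rw [Pi.zero_apply, ← hu (Fin.castLE hJs a) (Fin.lt_def.mpr (a.2.trans_le hJm)), hsum]
      rfl)
  refine hm ?_
  rw [hsum]
  refine Finset.sum_eq_zero fun b _ => ?_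
  rw [show u (J.orderEmbOfFin rfl b) = 0 from congrFun key b, mul_zero]

omit [DecidableEq F] in
theorem IsNSC.det_ne_zero {s : ℕ} {A : Matrix (Fin s) (Fin s) F} (hA : IsNSC A) : A.det ≠ 0 :=
  hA s le_rfl id strictMono_id

theorem hammingNorm_prod {ι κ : Type} [Fintype ι] [Fintype κ] (x : ι × κ → F) :
    hammingNorm x = ∑ t, hammingNorm fun j => x (j, t) := by
  simp only [hammingNorm, Finset.card_filter]
  rw [Fintype.sum_prod_type_right]

theorem mul_hammingNorm_le {ι κ : Type} [Fintype ι] [Fintype κ] (x : ι × κ → F) (c : κ → F)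
    (a : ℕ) (h : ∀ t, c t ≠ 0 → a ≤ hammingNorm fun j => x (j, t)) :
    a * hammingNorm c ≤ hammingNorm x := by
  rw [hammingNorm_prod, mul_comm, ← smul_eq_mul]
  calc hammingNorm c • a ≤ ∑ t with c t ≠ 0, hammingNorm fun j => x (j, t) :=
        Finset.card_nsmul_le_sum _ _ _ fun t ht => h t (by simpa using ht)
    _ ≤ ∑ t, hammingNorm fun j => x (j, t) :=
        Finset.sum_le_sum_of_subset (Finset.subset_univ _)

omit [DecidableEq F] in
theorem finrank_matrixProductCode {n s : ℕ} (C : Fin s → Submodule F (Fin n → F))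
    {A : Matrix (Fin s) (Fin s) F} (hA : A.det ≠ 0) :
    Module.finrank F (matrixProductCode C A) = ∑ i, Module.finrank F (C i) := by
  let f : ((i : Fin s) → C i) →ₗ[F] (Fin s × Fin n → F) :=
    { toFun := fun c jt => ∑ i, A i jt.1 * (c i : Fin n → F) jt.2
      map_add' := fun c d => by
        ext jt
        simp [mul_add, Finset.sum_add_distrib]
      map_smul' := fun r c => by
        ext jt
        simp [Finset.mul_sum, mul_left_comm] }
  have hf : Function.Injective f := by
    rw [injective_iff_map_eq_zero]
    intro c hc
    ext i t
    refine congrFun (Matrix.eq_zero_of_vecMul_eq_zero hA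
      (v := fun i => (c i : Fin n → F) t) ?_) i
    ext j
    refine Eq.trans ?_ (congrFun hc (j, t))
    change ∑ i, (c i : Fin n → F) t * A i j = ∑ i, A i j * (c i : Fin n → F) t
    exact Finset.sum_congr rfl fun i _ => mul_comm _ _
  have hr : LinearMap.range f = matrixProductCode C A := by
    ext x
    constructor
    · rintro ⟨c, rfl⟩
      exact ⟨fun i => c i, fun i => (c i).2, fun _ => rfl⟩
    · rintro ⟨c, hc, hx⟩
      exact ⟨fun i => ⟨c i, hc i⟩, funext fun jt => (hx jt).symm⟩
  rw [← hr, LinearMap.finrank_range_of_inj hf, Module.finrank_pi_fintype]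

theorem exists_le_hammingNorm_of_mem_matrixProductCode {n s : ℕ}
    {C : Fin s → Submodule F (Fin n → F)} {d : Fin s → ℕ} (hd : ∀ i, minDistGe (C i) (d i))
    {A : Matrix (Fin s) (Fin s) F} (hA : IsNSC A) {x : Fin s × Fin n → F}
    (hx : x ∈ matrixProductCode C A) (hx0 : x ≠ 0) :
    ∃ m : Fin s, (s - (m : ℕ)) * d m ≤ hammingNorm x := by
  obtain ⟨c, hc, hxc⟩ := hx
  have hne : ∃ i, c i ≠ 0 := by
    by_contra! h
    exact hx0 (funext fun jt => by simp [hxc, h])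
  obtain ⟨m, hm, hmax⟩ := Finset.exists_maximal (s := ({i | c i ≠ 0} : Finset (Fin s)))
    (by simpa [Finset.Nonempty] using hne)
  have hzero (i : Fin s) (hi : m < i) : c i = 0 := by
    by_contra h
    exact absurd (hmax (by simpa using h) hi.le) (not_le.mpr hi)
  have hm0 : c m ≠ 0 := by simpa using hm
  refine ⟨m, (Nat.mul_le_mul_left _ (hd m _ (hc m) hm0)).trans (mul_hammingNorm_le x (c m) _ ?_)⟩
  intro t ht
  have hxt : (fun j => x (j, t)) = (fun i => c i t) ᵥ* A := by
    ext j
    rw [hxc]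
    exact Finset.sum_congr rfl fun i _ => mul_comm _ _
  rw [hxt]
  exact hA.le_hammingNorm_vecMul (fun i hi => by rw [hzero i hi, Pi.zero_apply]) ht

theorem exists_le_hammingNorm_of_mem_euclidDual_matrixProductCode {n s : ℕ}
    {C : Fin s → Submodule F (Fin n → F)} {d : Fin s → ℕ}
    (hd : ∀ i, minDistGe (euclidDual (C i)) (d i))
    {A : Matrix (Fin s) (Fin s) F} (hA : IsNSC A) {u : Fin s × Fin n → F}
    (hu : u ∈ euclidDual (matrixProductCode C A)) (hu0 : u ≠ 0) :
    ∃ m : Fin s, ((m : ℕ) + 1) * d m ≤ hammingNorm u := by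
  let w : Fin s → Fin n → F := fun i t => (A *ᵥ fun j => u (j, t)) i
  have hw (i : Fin s) : w i ∈ euclidDual (C i) := by
    intro c hc
    rw [← hu (fun jt => A i jt.1 * c jt.2) ⟨Pi.single i c, fun i' => ?_, fun jt => ?_⟩]
    · rw [Fintype.sum_prod_type_right]
      refine Finset.sum_congr rfl fun t _ => ?_
      simp only [w, Matrix.mulVec, dotProduct, Finset.sum_mul, id]
      exact Finset.sum_congr rfl fun j _ => by ring
    · obtain rfl | h := eq_or_ne i' i
      · simpa using hc
      · simp [h]
    · rw [Finset.sum_eq_single i (fun i' _ h => by simp [h]) (by simp)]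
      simp
  have hne : ∃ i, w i ≠ 0 := by
    by_contra! h
    refine hu0 (funext fun jt => ?_)
    exact congrFun (Matrix.eq_zero_of_mulVec_eq_zero hA.det_ne_zero
      (v := fun j => u (j, jt.2)) (funext fun i => congrFun (h i) jt.2)) jt.1
  obtain ⟨m, hm, hmin⟩ := Finset.exists_minimal (s := ({i | w i ≠ 0} : Finset (Fin s)))
    (by simpa [Finset.Nonempty] using hne)
  have hzero (i : Fin s) (hi : i < m) : w i = 0 := by
    by_contra h
    exact absurd (hmin (by simpa using h) hi.le) (not_le.mpr hi)
  have hm0 : w m ≠ 0 := by simpa using hm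
  refine ⟨m, (Nat.mul_le_mul_left _ (hd m _ (hw m) hm0)).trans (mul_hammingNorm_le u (w m) _ ?_)⟩
  exact fun t ht => hA.le_hammingNorm_of_mulVec (fun i hi => congrFun (hzero i hi) t) ht

omit [DecidableEq F] in
theorem finrank_euclidDual {N : Type} [Fintype N] [DecidableEq N] (C : Submodule F (N → F)) :
    Module.finrank F (euclidDual C) = Fintype.card N - Module.finrank F C := by
  have h : euclidDual C = C.dualAnnihilator.comap (dotProductEquiv F N).toLinearMap := by
    ext u
    rw [Submodule.mem_comap, Submodule.mem_dualAnnihilator]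
    rfl
  have h1 := Subspace.finrank_add_finrank_dualAnnihilator_eq C
  rw [Module.finrank_fintype_fun_eq_card] at h1
  rw [h, LinearEquiv.finrank_eq ((dotProductEquiv F N).ofSubmodule' _)]
  omega

omit [DecidableEq F] in
/-- A monomial matrix acts on vectors by a permutation of the coordinates followed by a
nonzero scaling of each of them. -/
theorem IsMonomial.exists_mulVec_apply {N : Type} [Fintype N] {M : Matrix N N F}
    (hM : IsMonomial M) : ∃ (g : N ≃ N) (a : N → F), (∀ i, a i ≠ 0) ∧
      ∀ u i, (M *ᵥ u) i = a i * u (g i) := by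
  choose f hf hf' using hM.1
  have hinj : Function.Injective f := fun i i' h =>
    (hM.2 (f i)).unique (hf i) (by rw [h]; exact hf i')
  refine ⟨Equiv.ofBijective f (Finite.injective_iff_bijective.mp hinj), fun i => M i (f i), hf,
    fun u i => Finset.sum_eq_single (f i) (fun j _ hj => ?_) (by simp)⟩
  exact mul_eq_zero_of_left (not_not.mp fun h => hj (hf' i j h)) _

/-- The `σ` dual corresponds to the Euclidean dual under a weight-preserving bijection. -/
theorem exists_equiv_sigmaDual_iff {N : Type} [Fintype N] (p e : ℕ) [ExpChar F p]
    [PerfectRing F p] {M : Matrix N N F} (hM : IsMonomial M) :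
    ∃ φ : (N → F) ≃ (N → F), (∀ u, hammingNorm (φ u) = hammingNorm u) ∧
      ∀ (C : Submodule F (N → F)) (u), u ∈ sigmaDual p e M C ↔ φ u ∈ euclidDual C := by
  obtain ⟨g, a, ha, hg⟩ := hM.exists_mulVec_apply
  let F' := iterateFrobeniusEquiv F p e
  let φ : (N → F) ≃ (N → F) := (Equiv.arrowCongr g.symm (Equiv.refl F)).trans
    (Equiv.piCongrRight fun i => (Equiv.mulLeft₀ (a i) (ha i)).trans F'.symm.toEquiv)
  have hφ (u : N → F) (i : N) : φ u i = F'.symm (a i * u (g i)) := rfl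
  refine ⟨φ, fun u => ?_, fun C u => ?_⟩
  · refine Finset.card_equiv g fun i => ?_
    simp [hφ, ha]
  · refine forall₂_congr fun c _ => ?_
    refine Iff.trans (Eq.congr_left ?_) (map_eq_zero_iff F' F'.injective)
    rw [map_sum]
    change u ⬝ᵥ (piEv p e c ᵥ* M) = _
    rw [dotProduct_comm, ← Matrix.dotProduct_mulVec]
    refine Finset.sum_congr rfl fun i _ => ?_
    rw [hg, hφ, map_mul, RingEquiv.apply_symm_apply, mul_comm]
    rfl

theorem finrank_sigmaDual {N : Type} [Fintype N] [DecidableEq N] [Finite F] (p e : ℕ)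
    [ExpChar F p] {M : Matrix N N F} (hM : IsMonomial M) (C : Submodule F (N → F)) :
    Module.finrank F (sigmaDual p e M C) = Fintype.card N - Module.finrank F C := by
  obtain ⟨φ, -, hφ⟩ := exists_equiv_sigmaDual_iff p e hM
  have hcard : Nat.card (sigmaDual p e M C) = Nat.card (euclidDual C) :=
    Nat.card_congr (φ.subtypeEquiv (hφ C))
  rw [Module.natCard_eq_pow_finrank (K := F) (V := sigmaDual p e M C),
    Module.natCard_eq_pow_finrank (K := F) (V := euclidDual C)] at hcard
  rw [Nat.pow_right_injective Finite.one_lt_card hcard, finrank_euclidDual]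

/-- parameters of a matrix-product code with NSC defining matrix, and of its
`σ'` dual: `C(A)` is an `[sn, ∑ k_i, ≥ min (s+1-i)d_i]` code and `C(A)^{⊥σ'}` is an
`[sn, sn - ∑ k_i, ≥ min i·d_i^{⊥E}]` code. -/
theorem stmt4 {p h : ℕ} (hp : p.Prime) (hh : 0 < h)
    {F : Type} [Field F] [Fintype F] [DecidableEq F] (hcard : Fintype.card F = p ^ h)
    {n s : ℕ} (hs : 0 < s)
    (C : Fin s → Submodule F (Fin n → F)) (k d dE : Fin s → ℕ)
    (hk : ∀ i, Module.finrank F (C i) = k i)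
    (hk0 : ∀ i, 0 < k i) (hkn : ∀ i, k i < n)
    (hd : ∀ i, minDistEq (C i) (d i))
    (hdE : ∀ i, minDistEq (euclidDual (C i)) (dE i))
    (A : Matrix (Fin s) (Fin s) F) (hA : IsNSC A)
    (e' : ℕ) (he' : e' < h)
    (Mτ' : Matrix (Fin s × Fin n) (Fin s × Fin n) F) (hMτ' : IsMonomial Mτ') :
    Module.finrank F (matrixProductCode C A) = ∑ i, k i ∧
    minDistGe (matrixProductCode C A)
      (Finset.univ.inf' (Finset.univ_nonempty_iff.mpr ⟨⟨0, hs⟩⟩)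
        fun i : Fin s => (s - (i : ℕ)) * d i) ∧
    Module.finrank F (sigmaDual p e' Mτ' (matrixProductCode C A)) = s * n - ∑ i, k i ∧
    minDistGe (sigmaDual p e' Mτ' (matrixProductCode C A))
      (Finset.univ.inf' (Finset.univ_nonempty_iff.mpr ⟨⟨0, hs⟩⟩)
        fun i : Fin s => ((i : ℕ) + 1) * dE i) := by
  have : Fact p.Prime := ⟨hp⟩
  have : CharP F p := charP_of_card_eq_prime_pow hcard
  have hdim : Module.finrank F (matrixProductCode C A) = ∑ i, k i := by
    rw [finrank_matrixProductCode C hA.det_ne_zero]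
    exact Finset.sum_congr rfl fun i _ => hk i
  refine ⟨hdim, fun x hx hx0 => ?_, ?_, fun u hu hu0 => ?_⟩
  · obtain ⟨m, hm⟩ :=
      exists_le_hammingNorm_of_mem_matrixProductCode (fun i => (hd i).1) hA hx hx0
    exact (Finset.inf'_le _ (Finset.mem_univ m)).trans hm
  · rw [finrank_sigmaDual p e' hMτ', hdim, Fintype.card_prod, Fintype.card_fin, Fintype.card_fin]
  · obtain ⟨φ, hw, hφ⟩ := exists_equiv_sigmaDual_iff p e' hMτ'
    have hφ0 : φ u ≠ 0 := by
      rwa [← hammingNorm_ne_zero_iff, hw, hammingNorm_ne_zero_iff]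
    obtain ⟨m, hm⟩ := exists_le_hammingNorm_of_mem_euclidDual_matrixProductCode
      (fun i => (hdE i).1) hA ((hφ _ u).mp hu) hφ0
    rw [hw] at hm
    exact (Finset.inf'_le _ (Finset.mem_univ m)).trans hm
end

section
/- Let C ⊆ F_q^n be any linear code, let 0 ≤ e, e' ≤ h−1 with e' ≡ h − e (mod h), let M_τ and M_{τ'} be n×n monomial matrices over F_q, and set σ = (M_τ, e) and σ' = (M_{τ'}, e'). If π_e(M_{τ'}) = t·M_τ^T for some t ∈ F_q^*, then (C^{⊥σ'})^{⊥σ} = C. -/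
open Matrix Finset Kronecker

variable {F : Type} [Field F] [DecidableEq F]

/-- Over a finite field of order `p ^ h`, the maps `π_{e'}` and `π_e` are mutually inverse when
`e' ≡ h - e` modulo `h`. -/
theorem pow_pow_eq_self_of_add_modEq {K : Type} [Field K] [Fintype K] {p h e e' : ℕ}
    (hcard : Fintype.card K = p ^ h) (he : e < h) (he' : e' < h) (hee' : e' % h = (h - e) % h)
    (x : K) : (x ^ p ^ e') ^ p ^ e = x := by
  rw [← pow_mul, ← pow_add]
  rcases Nat.eq_zero_or_pos e with rfl | hpos
  · have : e' = 0 := by simpa [Nat.mod_eq_of_lt he'] using hee'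
    simp [this]
  · rw [Nat.mod_eq_of_lt he', Nat.mod_eq_of_lt (by omega)] at hee'
    rw [show e' + e = h by omega, ← hcard, FiniteField.pow_card]

theorem dotProduct_pow_char_pow {K n : Type} [Field K] [Fintype n] (p e : ℕ) [Fact p.Prime]
    [CharP K p] (u v : n → K) : (u ⬝ᵥ v) ^ p ^ e = piEv p e u ⬝ᵥ piEv p e v := by
  simp only [dotProduct, piEv, sum_pow_char_pow, mul_pow]

theorem piEv_vecMul {K m n : Type} [Field K] [Fintype m] (p e : ℕ) [Fact p.Prime]
    [CharP K p] (v : m → K) (A : Matrix m n K) :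
    piEv p e (v ᵥ* A) = piEv p e v ᵥ* piE p e A :=
  funext fun _ => dotProduct_pow_char_pow p e _ _

theorem IsMonomial.vecMul_surjective {K n : Type} [Field K] [Fintype n] {M : Matrix n n K}
    (hM : IsMonomial M) : Function.Surjective fun v => v ᵥ* M := by
  intro w
  choose c hc hcu using hM.1
  refine ⟨fun i => w (c i) / M i (c i), funext fun j => ?_⟩
  obtain ⟨i, hi, hiu⟩ := hM.2 j
  have hcij : j = c i := hcu i j hi
  change ∑ k, w (c k) / M k (c k) * M k j = w j
  rw [Finset.sum_eq_single i]
  · rw [← hcij, div_mul_cancel₀ _ hi]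
  · intro k _ hk
    rw [not_not.1 fun hkj => hk (hiu k hkj), mul_zero]
  · exact fun hi => absurd (Finset.mem_univ i) hi

/-- A vector orthogonal to everything orthogonal to a subspace lies in that subspace. -/
theorem mem_of_forall_dotProduct_eq_zero {K n : Type} [Field K] [Fintype n]
    {C : Submodule K (n → K)} {v : n → K}
    (hv : ∀ w : n → K, (∀ c ∈ C, w ⬝ᵥ c = 0) → v ⬝ᵥ w = 0) : v ∈ C := by
  classical
  by_contra hvC
  obtain ⟨f, hfv, hfC⟩ := Submodule.exists_le_ker_of_notMem hvC
  have hf (x : n → K) : (fun i => f (Pi.single i 1)) ⬝ᵥ x = f x := by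
    rw [LinearMap.pi_apply_eq_sum_univ f x, dotProduct_comm]
    simp only [dotProduct, smul_eq_mul]
    refine Finset.sum_congr rfl fun i _ => ?_
    congr 2
    ext j
    simp [Pi.single_apply, eq_comm]
  refine hfv ?_
  rw [← hf v, dotProduct_comm]
  exact hv _ fun c hc => (hf c).trans (hfC hc)

/-- with `e' ≡ h - e (mod h)` and `π_e(M_{τ'}) = t · M_τᵀ` for some `t ≠ 0`,
one has `(C^{⊥σ'})^{⊥σ} = C` for every linear code `C ⊆ F_q^n`. -/
theorem stmt5 {p h : ℕ} (hp : p.Prime) (hh : 0 < h)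
    {F : Type} [Field F] [Fintype F] [DecidableEq F] (hcard : Fintype.card F = p ^ h)
    {n : ℕ} (C : Submodule F (Fin n → F))
    (e e' : ℕ) (he : e < h) (he' : e' < h) (hee' : e' % h = (h - e) % h)
    (Mτ Mτ' : Matrix (Fin n) (Fin n) F)
    (hMτ : IsMonomial Mτ) (hMτ' : IsMonomial Mτ')
    (t : F) (ht : t ≠ 0) (hrel : piE p e Mτ' = t • Mτᵀ) :
    sigmaDual p e Mτ (sigmaDual p e' Mτ' C) = C := by
  have : Fact p.Prime := ⟨hp⟩
  have : CharP F p := charP_of_card_eq_prime_pow hcard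
  have hinv (x : F) : (x ^ p ^ e') ^ p ^ e = x :=
    pow_pow_eq_self_of_add_modEq hcard he he' hee' x
  have hdual (u : Fin n → F) : u ∈ sigmaDual p e' Mτ' C ↔
      ∀ c ∈ C, (piEv p e u ᵥ* Mτ) ⬝ᵥ c = 0 := by
    refine forall₂_congr fun c _ => ?_
    have hpow : (u ⬝ᵥ (piEv p e' c ᵥ* Mτ')) ^ p ^ e = t * ((piEv p e u ᵥ* Mτ) ⬝ᵥ c) := by
      rw [dotProduct_pow_char_pow, piEv_vecMul, hrel, vecMul_smul, dotProduct_smul, smul_eq_mul,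
        vecMul_transpose, dotProduct_mulVec]
      congr 3
      exact funext fun i => hinv (c i)
    change u ⬝ᵥ (piEv p e' c ᵥ* Mτ') = 0 ↔ _
    rw [← pow_eq_zero_iff (pow_ne_zero e hp.ne_zero), hpow, mul_eq_zero, or_iff_right ht]
  ext v
  constructor
  · intro hv
    refine mem_of_forall_dotProduct_eq_zero fun w hw => ?_
    obtain ⟨z, rfl⟩ := hMτ.vecMul_surjective w
    obtain ⟨u, rfl⟩ : ∃ u, piEv p e u = z := ⟨piEv p e' z, funext fun i => hinv (z i)⟩
    exact hv u ((hdual u).2 hw)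
  · intro hv u hu
    change v ⬝ᵥ (piEv p e u ᵥ* Mτ) = 0
    rw [dotProduct_comm]
    exact (hdual u).1 hu v hv
end

section
/- Let 0 ≤ e ≤ h−1, let C_1,…,C_s ⊆ F_q^n be linear codes, and let A be a non-singular s×s Toeplitz matrix over F_q. Let M_{τ'} be an n×n monomial matrix, D an s×s invertible diagonal matrix over F_q, σ' = (M_{τ'}, e), and σ = (M_τ, e) with M_τ = D ⊗ M_{τ'}. Then C(A)^{⊥σ} = [C_s^{⊥σ'}, C_{s−1}^{⊥σ'}, …, C_1^{⊥σ'}]·(π_e(A)^{-1}·Q·D^{-1}), where C(A) = [C_1,…,C_s]·A. -/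
open Matrix Finset Kronecker

variable {F : Type} [Field F] [DecidableEq F]

/-- Entries of a Toeplitz matrix agree after translating both indices by `k`. -/
theorem IsToeplitz.apply_add {F : Type} [Field F] {s : ℕ} {A : Matrix (Fin s) (Fin s) F}
    (hT : IsToeplitz A) (i j k : ℕ) (hi : i + k < s) (hj : j + k < s) :
    A ⟨i, by omega⟩ ⟨j, by omega⟩ = A ⟨i + k, hi⟩ ⟨j + k, hj⟩ := by
  induction k with
  | zero => rfl
  | succ k ih => exact (ih (by omega) (by omega)).trans (hT (i + k) (j + k) hi hj)

/-- Entries of a Toeplitz matrix agree when they lie on the same diagonal. -/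
theorem IsToeplitz.apply_eq_apply {F : Type} [Field F] {s : ℕ} {A : Matrix (Fin s) (Fin s) F}
    (hT : IsToeplitz A) {i j i' j' : Fin s} (h : (i : ℕ) + j' = i' + j) :
    A i j = A i' j' := by
  wlog hle : (i : ℕ) ≤ i' generalizing i j i' j'
  · exact (this h.symm (by omega)).symm
  have key := hT.apply_add i j (i' - i) (by omega) (by omega)
  have hi : (i : ℕ) + (i' - i) = i' := by omega
  have hj : (j : ℕ) + (i' - i) = j' := by omega
  simpa only [hi, hj] using key

/-- Conjugating a Toeplitz matrix by the order reversal transposes it. -/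
theorem IsToeplitz.submatrix_rev {F : Type} [Field F] {s : ℕ} {A : Matrix (Fin s) (Fin s) F}
    (hT : IsToeplitz A) : A.submatrix Fin.revPerm Fin.revPerm = Aᵀ := by
  ext i j
  simp only [submatrix_apply, transpose_apply, Fin.revPerm_apply]
  apply hT.apply_eq_apply
  simp only [Fin.val_rev]
  omega

/-- The inverse of a Toeplitz matrix is persymmetric. -/
theorem IsToeplitz.inv_apply_rev {F : Type} [Field F] {s : ℕ} {A : Matrix (Fin s) (Fin s) F}
    (hT : IsToeplitz A) (i j : Fin s) : A⁻¹ i.rev j.rev = A⁻¹ j i := by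
  have h := congrArg (fun B => B⁻¹ i j) hT.submatrix_rev
  simpa [inv_submatrix_equiv, ← transpose_nonsing_inv] using h

theorem IsToeplitz.piE {F : Type} [Field F] {s : ℕ} {A : Matrix (Fin s) (Fin s) F}
    (hT : IsToeplitz A) (p e : ℕ) : IsToeplitz (piE p e A) :=
  fun i j hi hj => congrArg (· ^ p ^ e) (hT i j hi hj)

theorem isUnit_det_piE {F : Type} [Field F] {p : ℕ} [Fact p.Prime] [CharP F p] (e : ℕ)
    {s : ℕ} {A : Matrix (Fin s) (Fin s) F} (hA : IsUnit A.det) : IsUnit (piE p e A).det := by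
  have h : piE p e A = (iterateFrobenius F p e).mapMatrix A := by
    ext i j
    simp [piE, iterateFrobenius_def]
  rw [h, ← RingHom.map_det]
  exact hA.map _

theorem mul_antiDiagQ_apply {F : Type} [Field F] {s : ℕ} (B : Matrix (Fin s) (Fin s) F)
    (i j : Fin s) : (B * antiDiagQ F s) i j = B i j.rev := by
  rw [mul_apply, Finset.sum_eq_single j.rev]
  · have h : (j.rev : ℕ) + j + 1 = s := by
      rw [Fin.val_rev]
      omega
    simp [antiDiagQ, -Fin.val_rev, h]
  · intro k _ hk
    have h : ¬ (k : ℕ) + j + 1 = s := by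
      rintro h
      apply hk
      ext
      rw [Fin.val_rev]
      omega
    simp [antiDiagQ, h]
  · simp

theorem mul_inv_diagonal_apply {F : Type} [Field F] {s : ℕ} (B : Matrix (Fin s) (Fin s) F)
    {D : Fin s → F} (hD : ∀ i, D i ≠ 0) (i j : Fin s) :
    (B * (Matrix.diagonal D)⁻¹) i j = B i j * (D j)⁻¹ := by
  have h : (Matrix.diagonal D)⁻¹ = Matrix.diagonal fun i => (D i)⁻¹ := by
    apply inv_eq_right_inv
    simp [diagonal_mul_diagonal, hD]
  rw [h, mul_diagonal]

theorem vecMul_diagonal_kronecker_apply {F : Type} [Field F] {n s : ℕ} (D : Fin s → F)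
    (M : Matrix (Fin n) (Fin n) F) (y : Fin s × Fin n → F) (j : Fin s) (t : Fin n) :
    (y ᵥ* (Matrix.diagonal D ⊗ₖ M)) (j, t) = D j * ((fun t' => y (j, t')) ᵥ* M) t := by
  simp only [vecMul, dotProduct, Fintype.sum_prod_type, kroneckerMap_apply, Finset.mul_sum]
  rw [Finset.sum_eq_single j]
  · refine Finset.sum_congr rfl fun t' _ => ?_
    rw [diagonal_apply_eq]
    ring
  · intro k _ hk
    simp [diagonal_apply_ne _ hk]
  · simp

/-- The `σ` pairing of `u` with a codeword of a matrix-product code splits as a sum of `σ'`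
pairings over the constituent codewords. -/
theorem sum_mul_vecMul_diagonal_kronecker {F : Type} [Field F] {p : ℕ} [Fact p.Prime]
    [CharP F p] (e : ℕ) {n s : ℕ} (A : Matrix (Fin s) (Fin s) F) (D : Fin s → F)
    (M : Matrix (Fin n) (Fin n) F) (u x : Fin s × Fin n → F) (c : Fin s → Fin n → F)
    (hx : ∀ jt : Fin s × Fin n, x jt = ∑ i, A i jt.1 * c i jt.2) :
    ∑ jt, u jt * (piEv p e x ᵥ* (Matrix.diagonal D ⊗ₖ M)) jt =
      ∑ i, ∑ t, (∑ j, piE p e A i j * (D j * u (j, t))) * (piEv p e (c i) ᵥ* M) t := by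
  have hrow (j : Fin s) :
      (fun t => piEv p e x (j, t)) = ∑ i, piE p e A i j • piEv p e (c i) := by
    ext t
    simp [piEv, piE, hx, sum_pow_char_pow, mul_pow]
  simp only [Fintype.sum_prod_type, vecMul_diagonal_kronecker_apply, hrow, sum_vecMul,
    smul_vecMul, Finset.sum_apply, Pi.smul_apply, smul_eq_mul, Finset.mul_sum, Finset.sum_mul]
  rw [Finset.sum_congr rfl fun j _ => Finset.sum_comm, Finset.sum_comm]
  refine Finset.sum_congr rfl fun i _ => ?_
  rw [Finset.sum_comm]
  refine Finset.sum_congr rfl fun t _ => Finset.sum_congr rfl fun j _ => ?_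
  ring

theorem mem_sigmaDual_matrixProductCode {F : Type} [Field F] {p : ℕ} [Fact p.Prime]
    [CharP F p] (e : ℕ) {n s : ℕ} (C : Fin s → Submodule F (Fin n → F))
    (A : Matrix (Fin s) (Fin s) F) (D : Fin s → F) (M : Matrix (Fin n) (Fin n) F)
    (u : Fin s × Fin n → F) :
    u ∈ sigmaDual p e (Matrix.diagonal D ⊗ₖ M) (matrixProductCode C A) ↔
      ∀ i, (fun t => ∑ j, piE p e A i j * (D j * u (j, t))) ∈ sigmaDual p e M (C i) := by
  constructor
  · intro hu i c hc
    have hmem : (fun jt : Fin s × Fin n =>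
        ∑ k, A k jt.1 * (Pi.single i c : Fin s → Fin n → F) k jt.2) ∈
          matrixProductCode C A := by
      refine ⟨Pi.single i c, fun k => ?_, fun _ => rfl⟩
      obtain rfl | hk := eq_or_ne k i
      · simpa using hc
      · simp [hk]
    have h := hu _ hmem
    rw [sum_mul_vecMul_diagonal_kronecker e A D M u _ _ fun _ => rfl,
      Finset.sum_eq_single i] at h
    · simpa using h
    · intro k _ hk
      have hzero : piEv p e (0 : Fin n → F) = 0 := by
        ext t
        simp [piEv, (Fact.out : p.Prime).ne_zero]
      simp [hk, hzero]
    · simp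
  · rintro hu x ⟨c, hc, hx⟩
    rw [sum_mul_vecMul_diagonal_kronecker e A D M u x c hx]
    exact Finset.sum_eq_zero fun i _ => hu i (c i) (hc i)

/-- Construction IV, part 1: for a non-singular Toeplitz matrix `A` and
`σ = (D ⊗ M_{τ'}, e)` with `D` invertible diagonal,
`C(A)^{⊥σ} = [C_s^{⊥σ'}, …, C_1^{⊥σ'}] · (π_e(A)⁻¹ · Q · D⁻¹)`. -/
theorem stmt9 {p h : ℕ} (hp : p.Prime) (hh : 0 < h)
    {F : Type} [Field F] [Fintype F] [DecidableEq F] (hcard : Fintype.card F = p ^ h)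
    (e : ℕ) (he : e < h)
    {n s : ℕ} (C : Fin s → Submodule F (Fin n → F))
    (A : Matrix (Fin s) (Fin s) F) (hAdet : IsUnit A.det) (hT : IsToeplitz A)
    (Mτ' : Matrix (Fin n) (Fin n) F) (hMτ' : IsMonomial Mτ')
    (D : Fin s → F) (hD : ∀ i, D i ≠ 0) :
    sigmaDual p e (Matrix.diagonal D ⊗ₖ Mτ') (matrixProductCode C A) =
      matrixProductCode (fun i => sigmaDual p e Mτ' (C i.rev))
        ((piE p e A)⁻¹ * antiDiagQ F s * (Matrix.diagonal D)⁻¹) := by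
  have : Fact p.Prime := ⟨hp⟩
  have : CharP F p := charP_of_card_eq_prime_pow hcard
  have hB : IsUnit (piE p e A).det := isUnit_det_piE e hAdet
  have hG (i j : Fin s) : ((piE p e A)⁻¹ * antiDiagQ F s * (Matrix.diagonal D)⁻¹) i.rev j =
      (piE p e A)⁻¹ j i * (D j)⁻¹ := by
    rw [mul_inv_diagonal_apply _ hD, mul_antiDiagQ_apply, (hT.piE p e).inv_apply_rev]
  ext u
  rw [mem_sigmaDual_matrixProductCode]
  have hsum (v : Fin s → Fin n → F) (j : Fin s) (t : Fin n) :
      ∑ i, ((piE p e A)⁻¹ * antiDiagQ F s * (Matrix.diagonal D)⁻¹) i j * v i t =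
        (D j)⁻¹ * ((piE p e A)⁻¹ *ᵥ fun i => v i.rev t) j := by
    rw [← Equiv.sum_comp Fin.revPerm]
    simp only [Fin.revPerm_apply, hG, mulVec, dotProduct, Finset.mul_sum]
    exact Finset.sum_congr rfl fun i _ => by ring
  constructor
  · intro hu
    refine ⟨fun i t => ∑ j, piE p e A i.rev j * (D j * u (j, t)), fun i => hu i.rev, ?_⟩
    rintro ⟨j, t⟩
    have hw : (fun i : Fin s => ∑ k, piE p e A i.rev.rev k * (D k * u (k, t))) =
        piE p e A *ᵥ fun k => D k * u (k, t) := by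
      ext i
      simp [mulVec, dotProduct]
    refine Eq.trans ?_ (hsum (fun i t => ∑ j, piE p e A i.rev j * (D j * u (j, t))) j t).symm
    rw [hw, mulVec_mulVec, nonsing_inv_mul _ hB, one_mulVec, inv_mul_cancel_left₀ (hD j)]
  · rintro ⟨v, hv, hu⟩ i
    have hw : (fun t => ∑ j, piE p e A i j * (D j * u (j, t))) = v i.rev := by
      ext t
      have hDu (j : Fin s) : D j * u (j, t) = ((piE p e A)⁻¹ *ᵥ fun k => v k.rev t) j := by
        rw [hu, hsum, mul_inv_cancel_left₀ (hD j)]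
      simp only [hDu]
      change (piE p e A *ᵥ ((piE p e A)⁻¹ *ᵥ fun k => v k.rev t)) i = _
      rw [mulVec_mulVec, mul_nonsing_inv _ hB, one_mulVec]
    rw [hw]
    simpa using hv i.rev
end
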